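/- Let τ ∈ ℂ with Im τ > 0, q := e^{2πiτ}. Let u, v ∈ ℂ∖(ℤ+ℤτ) with 2u, 2v ∉ ℤ+ℤτ, and set x := e^{2πiu}, y := e^{2πiv}; assume also −x, −y ∉ q^ℤ := {q^m : m ∈ ℤ}. Then the Weierstrass ℘-function for the lattice ℤ+ℤτ satisfies ℘(u) − ℘(v) = −(4π²x/q) · ((q+x)/(q−x)) · ((q;q)_∞²/θ(x²/q²)) · ₂ψ₆(−x, x/q; −x/q, x, 0, 0, 0, 0; q, x⁴/q²) + (4π²y/q) · ((q+y)/(q−y)) · ((q;q)_∞²/θ(y²/q²)) · ₂ψ₆(−y, y/q; −y/q, y, 0, 0, 0, 0; q, y⁴/q²). -/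

import Mathlib

noncomputable section

/-- `e z = exp(2πiz)`. -/
def e (z : ℂ) : ℂ := Complex.exp (2 * (Real.pi : ℂ) * Complex.I * z)

/-- Infinite q-Pochhammer symbol `(a;q)_∞`. -/
def qpinf (a q : ℂ) : ℂ := ∏' j : ℕ, (1 - a * q ^ j)

/-- `(a;q)_n` for `n : ℤ`, defined as `(a;q)_∞ / (a q^n;q)_∞`. -/
def qpint (a q : ℂ) (n : ℤ) : ℂ := qpinf a q / qpinf (a * q ^ n) q

/-- `θ(x) = (x;q)_∞ (q/x;q)_∞`. -/
def qtheta (q x : ℂ) : ℂ := qpinf x q * qpinf (q / x) q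

/-- Weierstrass ℘-function for the lattice ℤ+ℤτ. -/
def wp (τ u : ℂ) : ℂ :=
  1 / u ^ 2 + ∑' p : ℤ × ℤ,
    if p = (0, 0) then 0
    else 1 / (u - ((p.1 : ℂ) + (p.2 : ℂ) * τ)) ^ 2 - 1 / ((p.1 : ℂ) + (p.2 : ℂ) * τ) ^ 2

/-- `₂ψ₆(-t, t/q; -t/q, t, 0, 0, 0, 0; q, t⁴/q²)`. -/
def psi26 (q t : ℂ) : ℂ :=
  ∑' n : ℤ,
    qpint (-t) q n * qpint (t / q) q n /
      (qpint (-t / q) q n * qpint t q n * qpint 0 q n * qpint 0 q n * qpint 0 q n *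
        qpint 0 q n) *
      ((-1 : ℂ) ^ n * q ^ ((n * (n - 1)) / 2)) ^ 4 * (t ^ 4 / q ^ 2) ^ n

/-! ### The exponential `e` -/

lemma e_add (z w : ℂ) : e (z + w) = e z * e w := by
  simp only [e, ← Complex.exp_add]; ring_nf

lemma e_neg (z : ℂ) : e (-z) = (e z)⁻¹ := by
  simp only [e, ← Complex.exp_neg]; ring_nf

lemma e_ne_zero (z : ℂ) : e z ≠ 0 := Complex.exp_ne_zero _

@[simp] lemma e_zero : e 0 = 1 := by simp [e]

lemma e_int_mul (n : ℤ) (z : ℂ) : e (n * z) = e z ^ n := by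
  simp only [e, ← Complex.exp_int_mul]; ring_nf

lemma e_eq_one_iff {z : ℂ} : e z = 1 ↔ ∃ n : ℤ, z = n := by
  rw [e, Complex.exp_eq_one_iff]
  refine exists_congr fun n ↦ ?_
  have : (2 * (Real.pi : ℂ) * Complex.I) ≠ 0 := Complex.two_pi_I_ne_zero
  rw [mul_comm (n : ℂ), mul_right_inj' this]

@[simp] lemma e_intCast (n : ℤ) : e n = 1 := e_eq_one_iff.2 ⟨n, rfl⟩

lemma e_lattice (m n : ℤ) (τ : ℂ) : e (m + n * τ) = e τ ^ n := by
  rw [e_add, e_intCast, e_int_mul, one_mul]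

lemma e_eq_zpow_iff {z τ : ℂ} {n : ℤ} : e z = e τ ^ n ↔ ∃ m : ℤ, z = m + n * τ := by
  rw [← e_int_mul, ← div_eq_one_iff_eq (e_ne_zero _), div_eq_mul_inv, ← e_neg, ← e_add,
    e_eq_one_iff]
  exact exists_congr fun m ↦ ⟨fun h ↦ by linear_combination h, fun h ↦ by linear_combination h⟩

lemma norm_e (z : ℂ) : ‖e z‖ = Real.exp (-(2 * Real.pi * z.im)) := by
  simp [e, Complex.norm_exp]

lemma norm_e_lt_one {τ : ℂ} (hτ : 0 < τ.im) : ‖e τ‖ < 1 := by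
  rw [norm_e, Real.exp_lt_one_iff]
  have := Real.pi_pos
  have : 0 < 2 * Real.pi * τ.im := by positivity
  linarith

lemma hasDerivAt_e (z : ℂ) : HasDerivAt e (2 * Real.pi * Complex.I * e z) z := by
  have := ((hasDerivAt_id z).const_mul (2 * (Real.pi : ℂ) * Complex.I)).cexp
  convert! this using 1
  simp only [e, id]
  ring

@[fun_prop] lemma differentiable_e : Differentiable ℂ e :=
  fun z ↦ (hasDerivAt_e z).differentiableAt

@[fun_prop] lemma analyticAt_e (z : ℂ) : AnalyticAt ℂ e z := differentiable_e.analyticAt z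

/-! ### Infinite q-Pochhammer symbols and `qtheta` -/

lemma summable_norm_qpinf {q : ℂ} (hq : ‖q‖ < 1) (a : ℂ) :
    Summable fun j : ℕ ↦ ‖-(a * q ^ j)‖ := by
  simpa using (summable_geometric_of_lt_one (norm_nonneg _) hq).mul_left ‖a‖

lemma qpinf_eq_mul {q : ℂ} (hq : ‖q‖ < 1) (a : ℂ) :
    qpinf a q = (1 - a) * qpinf (a * q) q := by
  have h := multipliable_one_add_of_summable (summable_norm_qpinf hq (a * q))
  rw [qpinf, tprod_eq_zero_mul']
  · simp only [qpinf, pow_zero, mul_one, pow_succ', mul_assoc]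
  · simpa only [pow_succ', ← mul_assoc, ← sub_eq_add_neg] using h

@[simp] lemma qpinf_zero (q : ℂ) : qpinf 0 q = 1 := by simp [qpinf]

lemma qpinf_ne_zero {q a : ℂ} (hq : ‖q‖ < 1) (h : ∀ j : ℕ, a * q ^ j ≠ 1) : qpinf a q ≠ 0 := by
  simp only [qpinf, sub_eq_add_neg]
  refine tprod_one_add_ne_zero_of_summable (fun j ↦ ?_) (summable_norm_qpinf hq a)
  rw [← sub_eq_add_neg, sub_ne_zero]
  exact (h j).symm

lemma qpinf_ne_zero_of_ne_zpow {q a : ℂ} (hq : ‖q‖ < 1) (h : ∀ m : ℤ, a ≠ q ^ m) :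
    qpinf a q ≠ 0 := by
  refine qpinf_ne_zero hq fun j hj ↦ h (-j) ?_
  rw [zpow_neg, zpow_natCast]
  exact eq_inv_of_mul_eq_one_left hj

lemma qpinf_self_ne_zero {q : ℂ} (hq : ‖q‖ < 1) : qpinf q q ≠ 0 := by
  refine qpinf_ne_zero hq fun j hj ↦ ?_
  have : ‖q * q ^ j‖ < 1 := by
    rw [← pow_succ', norm_pow]
    exact pow_lt_one₀ (norm_nonneg _) hq (by simp)
  simp [hj] at this

lemma differentiable_qpinf {q : ℂ} (hq : ‖q‖ < 1) : Differentiable ℂ fun a ↦ qpinf a q := by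
  intro a
  have hP := Summable.hasProdLocallyUniformlyOn_nat_one_add
    (f := fun j a ↦ -(a * q ^ j)) (K := Metric.ball (0 : ℂ) (‖a‖ + 1))
    (u := fun j ↦ (‖a‖ + 1) * ‖q‖ ^ j) Metric.isOpen_ball
    ((summable_geometric_of_lt_one (norm_nonneg _) hq).mul_left _)
    (.of_forall fun j x hx ↦ by
      rw [norm_neg, norm_mul, norm_pow]
      gcongr
      exact (mem_ball_zero_iff.1 hx).le)
    (fun j ↦ by fun_prop)
  have hD := hP.differentiableOn
    (.of_forall fun s ↦ by
      simpa [Finset.prod_fn] using DifferentiableOn.finsetProd (fun _ _ ↦ by fun_prop))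
    Metric.isOpen_ball
  simp only [← sub_eq_add_neg] at hD
  exact hD.differentiableAt (Metric.isOpen_ball.mem_nhds (by simp))

lemma qtheta_mul {q : ℂ} (hq : ‖q‖ < 1) (hq0 : q ≠ 0) {x : ℂ} (hx : x ≠ 0) :
    qtheta q (q * x) = -x⁻¹ * qtheta q x := by
  have h1 : q / (q * x) = x⁻¹ := by field_simp
  rw [qtheta, qtheta, h1, qpinf_eq_mul hq x⁻¹, qpinf_eq_mul hq x, mul_comm q x,
    show x⁻¹ * q = q / x by ring]
  field_simp
  ring

lemma qtheta_inv {q : ℂ} (hq : ‖q‖ < 1) {x : ℂ} (hx : x ≠ 0) :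
    qtheta q x⁻¹ = -x⁻¹ * qtheta q x := by
  have h1 : q / x⁻¹ = x * q := by field_simp
  rw [qtheta, qtheta, h1, qpinf_eq_mul hq x⁻¹, qpinf_eq_mul hq x,
    show x⁻¹ * q = q / x by ring]
  field_simp
  ring

lemma exists_qtheta_zpow_mul {q : ℂ} (hq : ‖q‖ < 1) (hq0 : q ≠ 0) (n : ℤ) :
    ∃ A : ℂ, A ≠ 0 ∧ ∃ k : ℤ, ∀ x ≠ 0, qtheta q (q ^ n * x) = A * x ^ k * qtheta q x := by
  induction n with
  | zero => exact ⟨1, one_ne_zero, 0, by simp⟩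
  | succ n ih =>
    obtain ⟨A, hA, k, h⟩ := ih
    refine ⟨-(q ^ (n : ℤ))⁻¹ * A,
      mul_ne_zero (neg_ne_zero.2 (inv_ne_zero (zpow_ne_zero _ hq0))) hA, k - 1, fun x hx ↦ ?_⟩
    rw [zpow_add_one₀ hq0, mul_comm _ q, mul_assoc, qtheta_mul hq hq0 (by positivity), h x hx,
      zpow_sub_one₀ hx, mul_inv]
    ring
  | pred n ih =>
    obtain ⟨A, hA, k, h⟩ := ih
    refine ⟨-(q ^ (-(n : ℤ) - 1)) * A,
      mul_ne_zero (neg_ne_zero.2 (zpow_ne_zero _ hq0)) hA, k + 1, fun x hx ↦ ?_⟩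
    have h2 := qtheta_mul hq hq0 (x := q ^ (-(n : ℤ) - 1) * x) (by positivity)
    rw [← mul_assoc, ← zpow_one_add₀ hq0, show (1 : ℤ) + (-n - 1) = -n by ring, h x hx] at h2
    have h3 : q ^ (-(n : ℤ) - 1) ≠ 0 := by positivity
    rw [zpow_add_one₀ hx]
    field_simp at h2 ⊢
    linear_combination h2

lemma qtheta_ne_zero {q x : ℂ} (hq : ‖q‖ < 1) (hq0 : q ≠ 0) (h : ∀ m : ℤ, x ≠ q ^ m) :
    qtheta q x ≠ 0 := by
  refine mul_ne_zero (qpinf_ne_zero_of_ne_zpow hq h) (qpinf_ne_zero_of_ne_zpow hq fun m hm ↦ ?_)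
  have hx : x ≠ 0 := by
    rintro rfl
    simp only [div_zero] at hm
    exact zpow_ne_zero m hq0 hm.symm
  refine h (1 - m) ?_
  rw [zpow_sub₀ hq0, ← hm, zpow_one]
  field_simp

lemma analyticAt_qtheta {q x : ℂ} (hq : ‖q‖ < 1) (hx : x ≠ 0) : AnalyticAt ℂ (qtheta q) x := by
  have h := fun a ↦ (differentiable_qpinf hq).analyticAt a
  exact (h x).mul ((h (q / x)).comp (f := fun x ↦ q / x) (by fun_prop (disch := assumption)))

lemma hasDerivAt_qtheta_one {q : ℂ} (hq : ‖q‖ < 1) :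
    HasDerivAt (qtheta q) (-(qpinf q q ^ 2)) 1 := by
  have h : DifferentiableAt ℂ (fun x ↦ qpinf (x * q) q * qpinf (q / x) q) 1 := by
    have h := differentiable_qpinf hq
    exact ((h _).comp (f := fun x : ℂ ↦ x * q) 1 (by fun_prop)).mul
      ((h _).comp (f := fun x : ℂ ↦ q / x) 1 (by fun_prop (disch := simp)))
  have h2 := ((hasDerivAt_id (1 : ℂ)).const_sub 1).mul h.hasDerivAt
  have h3 : qtheta q = (fun x ↦ 1 - id x) * fun x ↦ qpinf (x * q) q * qpinf (q / x) q := by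
    ext x
    simp [qtheta, qpinf_eq_mul hq x, mul_assoc]
  rw [h3]
  convert! h2 using 1
  simp [sq]

open Filter Topology in
lemma Filter.Tendsto.comp_sub_const_nhdsNE {X : Type*} {l : Filter X} {f : ℂ → X} (c : ℂ)
    (h : Tendsto f (𝓝[≠] 0) l) : Tendsto (fun z ↦ f (z - c)) (𝓝[≠] c) l := by
  refine h.comp (tendsto_nhdsWithin_iff.2 ⟨?_, ?_⟩)
  · have : ContinuousAt (fun z : ℂ ↦ z - c) c := by fun_prop
    simpa using this.tendsto.mono_left nhdsWithin_le_nhds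
  · filter_upwards [self_mem_nhdsWithin] with z hz
    simpa [sub_eq_zero] using hz

/-! ### The Lambert-type series -/

/-- The summand `q^{2m²} x^{4m} (1 + x q^m) / (1 - x q^m)`, where `x = e w` and `q = e τ`. -/
def lambertTerm (τ : ℂ) (m : ℤ) (w : ℂ) : ℂ :=
  jacobiTheta₂_term m (4 * w) (4 * τ) * ((1 + e (w + m * τ)) / (1 - e (w + m * τ)))

/-- The series `∑ q^{2m²} x^{4m} (1 + x q^m) / (1 - x q^m)`, where `x = e w` and `q = e τ`. -/
def lambertSum (τ w : ℂ) : ℂ := ∑' m : ℤ, lambertTerm τ m w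

lemma jacobiTheta₂_term_eq_e (τ w : ℂ) (m : ℤ) :
    jacobiTheta₂_term m (4 * w) (4 * τ) = e (4 * m * w + 2 * m ^ 2 * τ) := by
  rw [jacobiTheta₂_term, e]
  ring_nf

lemma lambertSum_add_one (τ w : ℂ) : lambertSum τ (w + 1) = lambertSum τ w := by
  refine tsum_congr fun m ↦ ?_
  have h1 : e (w + 1 + m * τ) = e (w + m * τ) := by
    rw [add_right_comm, e_add, show (1 : ℂ) = (1 : ℤ) by simp, e_intCast, mul_one]
  have h2 : 4 * (m : ℂ) * (w + 1) + 2 * m ^ 2 * τ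
      = (4 * m * w + 2 * m ^ 2 * τ) + ((4 * m : ℤ) : ℂ) := by push_cast; ring
  rw [lambertTerm, lambertTerm, h1, jacobiTheta₂_term_eq_e, jacobiTheta₂_term_eq_e, h2,
    e_add _ (_ : ℂ), e_intCast, mul_one]

lemma lambertSum_add_self (τ w : ℂ) :
    lambertSum τ (w + τ) = e (-2 * τ - 4 * w) * lambertSum τ w := by
  rw [lambertSum, lambertSum, ← tsum_mul_left, ← (Equiv.addRight (1 : ℤ)).tsum_eq
    fun m ↦ e (-2 * τ - 4 * w) * lambertTerm τ m w]
  refine tsum_congr fun m ↦ ?_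
  simp only [lambertTerm, Equiv.coe_addRight, jacobiTheta₂_term_eq_e]
  rw [← mul_assoc, ← e_add]
  push_cast
  ring_nf

lemma lambertSum_neg (τ w : ℂ) : lambertSum τ (-w) = -lambertSum τ w := by
  rw [lambertSum, lambertSum, ← tsum_neg, ← (Equiv.neg ℤ).tsum_eq fun m ↦ -lambertTerm τ m w]
  refine tsum_congr fun m ↦ ?_
  simp only [lambertTerm, Equiv.neg_apply, jacobiTheta₂_term_eq_e]
  have h1 : e (w + ((-m : ℤ) : ℂ) * τ) = (e (-w + m * τ))⁻¹ := by
    rw [← e_neg]; push_cast; ring_nf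
  rw [h1, ← mul_neg]
  congr 1
  · push_cast; ring_nf
  · have := e_ne_zero (-w + m * τ)
    generalize e (-w + m * τ) = y at *
    have h2 : 1 + y⁻¹ = (1 + y) * y⁻¹ := by field_simp; ring
    have h3 : 1 - y⁻¹ = -(1 - y) * y⁻¹ := by field_simp; ring
    rw [h2, h3, mul_div_mul_right _ _ (inv_ne_zero this), div_neg, neg_neg]

lemma norm_one_add_div_one_sub_le {y : ℂ} (h : ‖y‖ ≤ 1 / 2 ∨ 2 ≤ ‖y‖) :
    ‖(1 + y) / (1 - y)‖ ≤ 3 := by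
  have h1 : ‖1 + y‖ ≤ 1 + ‖y‖ := by simpa using norm_add_le 1 y
  have h2 : 1 - ‖y‖ ≤ ‖1 - y‖ := by simpa using norm_sub_norm_le 1 y
  have h3 : ‖y‖ - 1 ≤ ‖1 - y‖ := by simpa [norm_sub_rev] using norm_sub_norm_le y 1
  rw [norm_div]
  refine div_le_of_le_mul₀ (norm_nonneg _) (by norm_num) ?_
  rcases h with h | h <;> linarith

lemma norm_e_le_half {z : ℂ} (h : 1 ≤ z.im) : ‖e z‖ ≤ 1 / 2 := by
  rw [norm_e, Real.exp_neg, one_div]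
  refine inv_anti₀ (by norm_num) ?_
  have := Real.add_one_le_exp (2 * Real.pi * z.im)
  nlinarith [Real.pi_gt_three]

lemma two_le_norm_e {z : ℂ} (h : z.im ≤ -1) : 2 ≤ ‖e z‖ := by
  rw [norm_e]
  have := Real.add_one_le_exp (-(2 * Real.pi * z.im))
  nlinarith [Real.pi_gt_three]

lemma one_sub_e_ne_zero_of_norm {z : ℂ} (h : ‖e z‖ ≤ 1 / 2 ∨ 2 ≤ ‖e z‖) : 1 - e z ≠ 0 := by
  intro h0
  rw [← sub_eq_zero.1 h0] at h
  norm_num at h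

@[fun_prop] lemma differentiable_jacobiTheta₂_term_four_mul (m : ℤ) (τ : ℂ) :
    Differentiable ℂ fun w ↦ jacobiTheta₂_term m (4 * w) (4 * τ) := by
  simp only [jacobiTheta₂_term_eq_e]
  fun_prop

lemma analyticAt_lambertTerm {τ w : ℂ} {m : ℤ} (h : e (w + m * τ) ≠ 1) :
    AnalyticAt ℂ (lambertTerm τ m) w := by
  have h1 := (differentiable_jacobiTheta₂_term_four_mul m τ).analyticAt w
  have h2 : Differentiable ℂ fun w ↦ e (w + m * τ) := by fun_prop
  have h3 := h2.analyticAt w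
  exact h1.mul ((analyticAt_const.add h3).div (analyticAt_const.sub h3) (sub_ne_zero.2 h.symm))

lemma meromorphicAt_lambertTerm (τ w : ℂ) (m : ℤ) : MeromorphicAt (lambertTerm τ m) w := by
  have h1 := (differentiable_jacobiTheta₂_term_four_mul m τ).analyticAt w
  have h2 : Differentiable ℂ fun w ↦ e (w + m * τ) := by fun_prop
  have h3 := h2.analyticAt w
  exact h1.meromorphicAt.mul ((analyticAt_const.add h3).meromorphicAt.div
    (analyticAt_const.sub h3).meromorphicAt)

open Filter Topology in
lemma exists_lambertSum_eventuallyEq {τ : ℂ} (hτ : 0 < τ.im) (w₀ : ℂ) :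
    ∃ (s : Finset ℤ) (R : ℂ → ℂ), 0 ∈ s ∧ AnalyticAt ℂ R w₀ ∧
      lambertSum τ =ᶠ[𝓝 w₀] fun w ↦ ∑ m ∈ s, lambertTerm τ m w + R w := by
  set B : ℝ := |w₀.im| + 1
  have hB : ∀ w ∈ Metric.ball w₀ 1, |w.im| ≤ B := by
    intro w hw
    have h1 : |(w - w₀).im| ≤ 1 :=
      (Complex.abs_im_le_norm _).trans (by simpa [dist_eq_norm] using (Metric.mem_ball.1 hw).le)
    have h2 := abs_add_le (w - w₀).im w₀.im
    rw [Complex.sub_im, sub_add_cancel] at h2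
    rw [Complex.sub_im] at h1
    simp only [B]
    linarith
  obtain ⟨N, hN⟩ := exists_nat_ge ((B + 1) / τ.im)
  rw [div_le_iff₀ hτ] at hN
  have hfar : ∀ w ∈ Metric.ball w₀ 1, ∀ m : ℤ, m ∉ Finset.Icc (-N : ℤ) N →
      ‖e (w + m * τ)‖ ≤ 1 / 2 ∨ 2 ≤ ‖e (w + m * τ)‖ := by
    intro w hw m hm
    have hw' := abs_le.1 (hB w hw)
    have him : (w + m * τ).im = w.im + m * τ.im := by simp
    rw [Finset.mem_Icc, not_and_or, not_le, not_le] at hm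
    rcases hm with hm | hm
    · refine Or.inr (two_le_norm_e ?_)
      have : (m : ℝ) ≤ -N := by exact_mod_cast hm.le
      rw [him]
      nlinarith
    · refine Or.inl (norm_e_le_half ?_)
      have : (N : ℝ) ≤ m := by exact_mod_cast hm.le
      rw [him]
      nlinarith
  set b : ℤ → ℝ := fun m ↦
    3 * Real.exp (-Real.pi * ((4 * τ).im * m ^ 2 - 2 * (4 * B) * |(m : ℝ)|))
  have h4τ : 0 < (4 * τ).im := by simpa using hτ
  have hb : Summable b := by
    have := (summable_pow_mul_jacobiTheta₂_term_bound (4 * B) h4τ 0).mul_left 3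
    simp only [pow_zero, one_mul, Int.cast_abs] at this
    exact this
  have hle : ∀ m : ℤ, m ∉ Finset.Icc (-N : ℤ) N → ∀ w ∈ Metric.ball w₀ 1,
      ‖lambertTerm τ m w‖ ≤ b m := by
    intro m hm w hw
    rw [lambertTerm, norm_mul, mul_comm]
    refine mul_le_mul (norm_one_add_div_one_sub_le (hfar w hw m hm)) ?_ (norm_nonneg _)
      (by norm_num)
    simpa using norm_jacobiTheta₂_term_le h4τ (z := 4 * w) (S := 4 * B)
      (by simpa [abs_mul] using hB w hw) le_rfl m
  have hbs : Summable fun m : {m // m ∉ Finset.Icc (-N : ℤ) N} ↦ b m := hb.subtype _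
  refine ⟨Finset.Icc (-N) N, fun w ↦ ∑' m : {m // m ∉ Finset.Icc (-N : ℤ) N}, lambertTerm τ m w,
    by simp, ?_, ?_⟩
  · have hd : DifferentiableOn ℂ
        (fun w ↦ ∑' m : {m // m ∉ Finset.Icc (-N : ℤ) N}, lambertTerm τ m w)
        (Metric.ball w₀ 1) := by
      refine Complex.differentiableOn_tsum_of_summable_norm hbs (fun m w hw ↦ ?_)
        Metric.isOpen_ball fun m w hw ↦ hle m m.2 w hw
      refine (analyticAt_lambertTerm ?_).differentiableAt.differentiableWithinAt
      exact (sub_ne_zero.1 (one_sub_e_ne_zero_of_norm (hfar w hw m m.2))).symm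
    exact hd.analyticAt (Metric.ball_mem_nhds _ one_pos)
  · filter_upwards [Metric.ball_mem_nhds w₀ one_pos] with w hw
    have h1 : Summable fun m : {m // m ∉ Finset.Icc (-N : ℤ) N} ↦ lambertTerm τ m w :=
      hbs.of_norm_bounded fun m ↦ hle m m.2 w hw
    have h2 : Summable fun m ↦ lambertTerm τ m w := (Finset.summable_compl_iff _).1 h1
    exact (h2.sum_add_tsum_subtype_compl _).symm

lemma meromorphicAt_lambertSum {τ : ℂ} (hτ : 0 < τ.im) (w : ℂ) :
    MeromorphicAt (lambertSum τ) w := by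
  obtain ⟨s, R, -, hR, h⟩ := exists_lambertSum_eventuallyEq hτ w
  refine MeromorphicAt.congr ?_ (h.filter_mono nhdsWithin_le_nhds).symm
  exact (MeromorphicAt.fun_sum fun m _ ↦ meromorphicAt_lambertTerm τ w m).add hR.meromorphicAt

lemma analyticAt_lambertSum {τ : ℂ} (hτ : 0 < τ.im) {w : ℂ} (hw : ∀ m : ℤ, e (w + m * τ) ≠ 1) :
    AnalyticAt ℂ (lambertSum τ) w := by
  obtain ⟨s, R, -, hR, h⟩ := exists_lambertSum_eventuallyEq hτ w
  refine AnalyticAt.congr ?_ h.symm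
  exact (Finset.analyticAt_fun_sum _ fun m _ ↦ analyticAt_lambertTerm (hw m)).add hR

open Filter Topology in
lemma tendsto_e_sub_one_div : Tendsto (fun z ↦ (e z - 1) / z) (𝓝[≠] 0)
    (𝓝 (2 * Real.pi * Complex.I)) := by
  have h := (hasDerivAt_e 0).tendsto_slope_zero
  simpa [div_eq_inv_mul] using h

open Filter Topology in
lemma tendsto_mul_lambertSum {τ : ℂ} (hτ : 0 < τ.im) :
    Tendsto (fun z ↦ z * lambertSum τ z) (𝓝[≠] 0) (𝓝 (-2 / (2 * Real.pi * Complex.I))) := by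
  obtain ⟨s, R, h0, hR, h⟩ := exists_lambertSum_eventuallyEq hτ 0
  set T : ℂ → ℂ := fun z ↦ ∑ m ∈ s.erase 0, lambertTerm τ m z + R z
  have hT : AnalyticAt ℂ T 0 := by
    refine (Finset.analyticAt_fun_sum _ fun m hm ↦ analyticAt_lambertTerm ?_).add hR
    intro h1
    have h2 := norm_e (0 + m * τ)
    rw [h1, norm_one, eq_comm, Real.exp_eq_one_iff] at h2
    have h3 : m ≠ 0 := Finset.ne_of_mem_erase hm
    simp [Real.pi_ne_zero, h3, hτ.ne'] at h2
  have h1 : Tendsto (fun z ↦ z * T z) (𝓝[≠] 0) (𝓝 0) := by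
    have : ContinuousAt (fun z ↦ z * T z) 0 := continuousAt_id.mul hT.continuousAt
    simpa [ContinuousAt] using this.mono_left nhdsWithin_le_nhds
  have h2 : Tendsto (fun z ↦ -(1 + e z) / ((e z - 1) / z)) (𝓝[≠] 0)
      (𝓝 (-2 / (2 * Real.pi * Complex.I))) := by
    refine Tendsto.div ?_ tendsto_e_sub_one_div Complex.two_pi_I_ne_zero
    have : ContinuousAt (fun z ↦ -(1 + e z)) 0 := by fun_prop
    convert! this.tendsto.mono_left nhdsWithin_le_nhds using 2
    rw [e_zero]
    norm_num
  have h3 := h2.add h1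
  rw [add_zero] at h3
  refine h3.congr' ?_
  filter_upwards [h.filter_mono nhdsWithin_le_nhds] with z hz
  rw [hz, ← Finset.add_sum_erase _ _ h0]
  simp only [T, lambertTerm, jacobiTheta₂_term_eq_e]
  simp only [Int.cast_zero, mul_zero, zero_mul, zero_pow two_ne_zero, add_zero, e_zero, one_mul]
  rw [div_div_eq_mul_div, ← neg_sub (1 : ℂ) (e z), div_neg]
  ring

/-! ### Elliptic functions without poles -/

open Filter Topology in
lemma meromorphicOrderAt_nonneg_of_symm {F : ℂ → ℂ} {c : ℂ} (hF : MeromorphicAt F c)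
    (hs : ∀ z, F (c + z) = F (c - z))
    (hl : Tendsto (fun z ↦ (z - c) ^ 2 * F z) (𝓝[≠] c) (𝓝 0)) :
    0 ≤ meromorphicOrderAt F c := by
  have hid : MeromorphicAt (fun z ↦ (z - c) ^ 2) c := by fun_prop
  have hpos := (tendsto_zero_iff_meromorphicOrderAt_pos (hid.mul hF)).1 hl
  rw [meromorphicOrderAt_mul hid hF, fun_meromorphicOrderAt_pow_id_sub_const] at hpos
  by_contra! hneg
  have hne : meromorphicOrderAt F c = ((-1 : ℤ) : WithTop ℤ) := by
    obtain ⟨n, hn⟩ := WithTop.ne_top_iff_exists.mp hneg.ne_top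
    rw [← hn] at hpos hneg ⊢
    have h1 : n < 0 := by exact_mod_cast hneg
    have h2 : 0 < 2 + n := by
      rw [← WithTop.coe_lt_coe]
      simpa using hpos
    congr 1
    omega
  obtain ⟨g, hg, hgc, h⟩ := (meromorphicOrderAt_eq_int_iff hF).1 hne
  have hadd : Tendsto (fun z ↦ c + z) (𝓝[≠] 0) (𝓝[≠] c) := by
    refine tendsto_nhdsWithin_iff.2 ⟨?_, ?_⟩
    · have : ContinuousAt (fun z : ℂ ↦ c + z) 0 := by fun_prop
      simpa using this.tendsto.mono_left nhdsWithin_le_nhds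
    · filter_upwards [self_mem_nhdsWithin] with z hz
      simpa using hz
  have hsub : Tendsto (fun z ↦ c - z) (𝓝[≠] 0) (𝓝[≠] c) := by
    refine tendsto_nhdsWithin_iff.2 ⟨?_, ?_⟩
    · have : ContinuousAt (fun z : ℂ ↦ c - z) 0 := by fun_prop
      simpa using this.tendsto.mono_left nhdsWithin_le_nhds
    · filter_upwards [self_mem_nhdsWithin] with z hz
      simpa using hz
  have hgt := hg.continuousAt.tendsto.mono_left (nhdsWithin_le_nhds (s := {c}ᶜ))
  have heq : (fun z ↦ g (c + z)) =ᶠ[𝓝[≠] 0] fun z ↦ -g (c - z) := by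
    filter_upwards [hadd.eventually h, hsub.eventually h, self_mem_nhdsWithin] with z h1 h2 hz
    have hz : z ≠ 0 := hz
    have h3 := hs z
    rw [h1, h2] at h3
    simp only [add_sub_cancel_left, sub_sub_cancel_left, zpow_neg_one, smul_eq_mul] at h3
    field_simp at h3
    exact h3
  have hlim := tendsto_nhds_unique ((hgt.comp hadd).congr' heq) (hgt.comp hsub).neg
  exact hgc (self_eq_neg.1 hlim)

open Filter Topology in
lemma PeriodPair.exists_const_of_meromorphicOrderAt_nonneg (L : PeriodPair) {F : ℂ → ℂ}
    (hF : ∀ z, MeromorphicAt F z) (hper : ∀ z, ∀ l ∈ L.lattice, F (z + l) = F z)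
    (hord : ∀ z, 0 ≤ meromorphicOrderAt F z) :
    ∃ C, ∀ z, ContinuousAt F z → F z = C := by
  have hFon : MeromorphicOn F Set.univ := fun z _ ↦ hF z
  set G := toMeromorphicNFOn F Set.univ
  have hFG : ∀ z, F =ᶠ[𝓝[≠] z] G := fun z ↦
    (hFon.toMeromorphicNFOn_eq_self_on_nhdsNE trivial).symm
  have hG : ∀ z, AnalyticAt ℂ G z := fun z ↦ by
    rw [← (meromorphicNFOn_toMeromorphicNFOn F Set.univ
      (Set.mem_univ z)).meromorphicOrderAt_nonneg_iff_analyticAt,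
      meromorphicOrderAt_toMeromorphicNFOn hFon (Set.mem_univ z)]
    exact hord z
  have hGd : Differentiable ℂ G := fun z ↦ (hG z).differentiableAt
  have hGper : ∀ z l, l ∈ L.lattice → G (z + l) = G z := by
    intro z l hl
    have hadd : Tendsto (fun w ↦ w + l) (𝓝[≠] z) (𝓝[≠] (z + l)) := by
      refine tendsto_nhdsWithin_iff.2 ⟨?_, ?_⟩
      · have : ContinuousAt (fun w : ℂ ↦ w + l) z := by fun_prop
        exact this.tendsto.mono_left nhdsWithin_le_nhds
      · filter_upwards [self_mem_nhdsWithin] with w hw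
        simpa using hw
    have h1 : (fun w ↦ G (w + l)) =ᶠ[𝓝[≠] z] G := by
      filter_upwards [hadd.eventually (hFG (z + l)), hFG z] with w h1 h2
      rw [← h1, ← h2, hper w l hl]
    have hc : ContinuousAt (fun w ↦ G (w + l)) z :=
      (hGd.continuous.comp (continuous_add_const l)).continuousAt
    exact ((hc.eventuallyEq_nhds_iff_eventuallyEq_nhdsNE hGd.continuous.continuousAt).1
      h1).eq_of_nhds
  have hbdd := (IsZLattice.isCompact_range_of_periodic L.lattice G hGd.continuous
    hGper).isBounded
  refine ⟨G 0, fun z hz ↦ ?_⟩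
  rw [← hGd.apply_eq_apply_of_bounded hbdd z 0]
  exact ((hz.eventuallyEq_nhds_iff_eventuallyEq_nhdsNE hGd.continuous.continuousAt).1
    (hFG z)).eq_of_nhds

/-! ### The lattice `ℤ + ℤτ` -/

/-- The pair of periods `1, τ`. -/
def periodPairOne (τ : ℂ) (hτ : 0 < τ.im) : PeriodPair where
  ω₁ := 1
  ω₂ := τ
  indep := by
    rw [LinearIndependent.pair_iff]
    intro s t h
    have h1 := congrArg Complex.im h
    have h2 := congrArg Complex.re h
    simp only [Complex.real_smul, Complex.add_im, Complex.mul_im, Complex.ofReal_re,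
      Complex.ofReal_im, Complex.one_im, zero_mul, mul_zero, add_zero, zero_add, Complex.zero_im,
      mul_eq_zero, hτ.ne', or_false] at h1
    simpa [h1] using h2

lemma mem_periodPairOne {τ : ℂ} {hτ : 0 < τ.im} {z : ℂ} :
    z ∈ (periodPairOne τ hτ).lattice ↔ ∃ m n : ℤ, z = m + n * τ := by
  simp [PeriodPair.mem_lattice, periodPairOne, eq_comm]

lemma wp_eq_weierstrassP {τ : ℂ} (hτ : 0 < τ.im) (u : ℂ) :
    wp τ u = (periodPairOne τ hτ).weierstrassP u := by
  set L := periodPairOne τ hτ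
  have h := L.weierstrassPExcept_add 0 u
  rw [← h, add_comm, wp]
  congr 1
  · simp
  rw [PeriodPair.weierstrassPExcept, ← L.latticeEquivProd.symm.toEquiv.tsum_eq]
  refine tsum_congr fun p ↦ ?_
  have hp : ((L.latticeEquivProd.symm p : L.lattice) : ℂ) = p.1 + p.2 * τ := by
    rw [L.latticeEquiv_symm_apply]
    simp [L, periodPairOne]
  have hp0 : ((L.latticeEquivProd.symm p : L.lattice) : ℂ) = ((0 : L.lattice) : ℂ) ↔
      p = (0, 0) := by
    rw [Subtype.coe_inj, LinearEquiv.map_eq_zero_iff]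
    rfl
  simp only [LinearEquiv.coe_toEquiv, hp0]
  rw [hp]

/-! ### The elliptic function built from the Lambert-type series -/

/-- The even elliptic function `x ∑ q^{2m²} x^{4m} (1 + x q^m) / (1 - x q^m) / θ(x²)`, where
`x = e w` and `q = e τ`. -/
def lambertQuot (τ w : ℂ) : ℂ := e w * lambertSum τ w / qtheta (e τ) (e (2 * w))

lemma lambertQuot_add_one (τ w : ℂ) : lambertQuot τ (w + 1) = lambertQuot τ w := by
  have h1 : e 1 = 1 := by simpa using e_intCast 1
  have h2 : e 2 = 1 := by simpa using e_intCast 2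
  rw [lambertQuot, lambertQuot, lambertSum_add_one, mul_add, mul_one, e_add, e_add (2 * w), h1, h2,
    mul_one, mul_one]

lemma lambertQuot_add_self {τ : ℂ} (hτ : 0 < τ.im) (w : ℂ) :
    lambertQuot τ (w + τ) = lambertQuot τ w := by
  have hq := norm_e_lt_one hτ
  have hq0 := e_ne_zero τ
  have hw := e_ne_zero w
  have h1 : e (2 * (w + τ)) = e τ * (e τ * e (2 * w)) := by
    rw [← e_add, ← e_add]; ring_nf
  have h2 : e (-2 * τ - 4 * w) = (e τ)⁻¹ * (e τ)⁻¹ * (e (2 * w))⁻¹ * (e (2 * w))⁻¹ := by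
    simp only [← e_neg, ← e_add]; ring_nf
  have h3 := e_ne_zero (2 * w)
  rw [lambertQuot, lambertQuot, lambertSum_add_self, h1, qtheta_mul hq hq0 (mul_ne_zero hq0 h3),
    qtheta_mul hq hq0 h3, h2, e_add]
  field_simp

lemma lambertQuot_neg {τ : ℂ} (hτ : 0 < τ.im) (w : ℂ) :
    lambertQuot τ (-w) = lambertQuot τ w := by
  have h1 : e (2 * w) = e w * e w := by rw [← e_add]; ring_nf
  have hw := e_ne_zero w
  rw [lambertQuot, lambertQuot, lambertSum_neg, mul_neg 2 w, e_neg, e_neg,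
    qtheta_inv (norm_e_lt_one hτ) (e_ne_zero _), h1]
  field_simp

lemma lambertQuot_add_lattice {τ : ℂ} (hτ : 0 < τ.im) (w : ℂ) (m n : ℤ) :
    lambertQuot τ (w + (m + n * τ)) = lambertQuot τ w := by
  have h1 : Function.Periodic (lambertQuot τ) 1 := lambertQuot_add_one τ
  have h2 : Function.Periodic (lambertQuot τ) τ := lambertQuot_add_self hτ
  simpa using ((h1.int_mul m).add_period (h2.int_mul n)) w

lemma analyticAt_qtheta_e {τ : ℂ} (hτ : 0 < τ.im) (w : ℂ) :
    AnalyticAt ℂ (fun w ↦ qtheta (e τ) (e (2 * w))) w :=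
  (analyticAt_qtheta (norm_e_lt_one hτ) (e_ne_zero _)).comp (f := fun w ↦ e (2 * w))
    ((analyticAt_e _).comp (f := fun w : ℂ ↦ 2 * w) (by fun_prop))

lemma meromorphicAt_lambertQuot {τ : ℂ} (hτ : 0 < τ.im) (w : ℂ) :
    MeromorphicAt (lambertQuot τ) w :=
  ((analyticAt_e w).meromorphicAt.mul (meromorphicAt_lambertSum hτ w)).div
    (analyticAt_qtheta_e hτ w).meromorphicAt

lemma e_add_int_mul_ne_one {τ w : ℂ} (h : ∀ m n : ℤ, w ≠ m + n * τ) (n : ℤ) :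
    e (w + n * τ) ≠ 1 := by
  intro h1
  obtain ⟨m, hm⟩ := e_eq_one_iff.1 h1
  refine h m (-n) ?_
  push_cast
  linear_combination hm

lemma ne_lattice_of_two_mul_ne {τ w : ℂ} (h : ∀ m n : ℤ, 2 * w ≠ m + n * τ) (m n : ℤ) :
    w ≠ m + n * τ := by
  rintro rfl
  refine h (2 * m) (2 * n) ?_
  push_cast
  ring

lemma analyticAt_lambertQuot {τ : ℂ} (hτ : 0 < τ.im) {w : ℂ}
    (h : ∀ m n : ℤ, 2 * w ≠ m + n * τ) : AnalyticAt ℂ (lambertQuot τ) w := by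
  refine ((analyticAt_e w).mul (analyticAt_lambertSum hτ
    (e_add_int_mul_ne_one (ne_lattice_of_two_mul_ne h)))).div (analyticAt_qtheta_e hτ w) ?_
  refine qtheta_ne_zero (norm_e_lt_one hτ) (e_ne_zero τ) fun n hn ↦ ?_
  obtain ⟨m, hm⟩ := e_eq_zpow_iff.1 hn
  exact h m n hm

open Filter Topology in
lemma tendsto_div_qtheta_e {τ : ℂ} (hτ : 0 < τ.im) :
    Tendsto (fun z ↦ z / qtheta (e τ) (e (2 * z))) (𝓝[≠] 0)
      (𝓝 (-(4 * Real.pi * Complex.I * qpinf (e τ) (e τ) ^ 2))⁻¹) := by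
  have hq := norm_e_lt_one hτ
  have h1 : HasDerivAt (fun z ↦ e (2 * z)) (2 * Real.pi * Complex.I * 2) 0 := by
    have h0 := (hasDerivAt_e (2 * 0)).comp 0 ((hasDerivAt_id (0 : ℂ)).const_mul 2)
    convert! h0 using 1
    simp
  have h2 : HasDerivAt (qtheta (e τ)) (-(qpinf (e τ) (e τ) ^ 2)) (e (2 * 0)) := by
    rw [mul_zero, e_zero]
    exact hasDerivAt_qtheta_one hq
  have h3 := (h2.comp 0 h1).tendsto_slope_zero
  have h0 : qtheta (e τ) 1 = 0 := by
    simp [qtheta, qpinf_eq_mul hq 1]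
  have hΦ := qpinf_self_ne_zero hq
  have hπ := Complex.two_pi_I_ne_zero
  have h4 := h3.inv₀ (mul_ne_zero (neg_ne_zero.2 (pow_ne_zero 2 hΦ))
    (mul_ne_zero hπ two_ne_zero))
  convert! h4 using 2
  · simp [h0, div_eq_mul_inv, mul_comm]
  · ring

open Filter Topology in
lemma tendsto_sq_mul_lambertQuot_zero {τ : ℂ} (hτ : 0 < τ.im) :
    Tendsto (fun z ↦ z ^ 2 * (4 * Real.pi ^ 2 * qpinf (e τ) (e τ) ^ 2 * lambertQuot τ z))
      (𝓝[≠] 0) (𝓝 (-1)) := by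
  have h1 := (tendsto_mul_lambertSum hτ).mul (tendsto_div_qtheta_e hτ)
  have h2 : Tendsto e (𝓝[≠] 0) (𝓝 1) := by
    simpa using (differentiable_e.continuous.tendsto 0).mono_left nhdsWithin_le_nhds
  have h3 := (h1.mul h2).const_mul (4 * Real.pi ^ 2 * qpinf (e τ) (e τ) ^ 2 : ℂ)
  convert! h3 using 2 with z
  · rw [lambertQuot]
    ring
  · have hΦ := qpinf_self_ne_zero (norm_e_lt_one hτ)
    have hπ : (Real.pi : ℂ) ≠ 0 := by exact_mod_cast Real.pi_ne_zero
    have hI := Complex.I_ne_zero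
    field_simp
    rw [Complex.I_sq]
    norm_num

open Filter Topology in
lemma tendsto_sq_mul_lambertQuot {τ c : ℂ} (hτ : 0 < τ.im) (h : ∀ m n : ℤ, c ≠ m + n * τ)
    {m n : ℤ} (hc : 2 * c = m + n * τ) :
    Tendsto (fun z ↦ (z - c) ^ 2 * lambertQuot τ z) (𝓝[≠] c) (𝓝 0) := by
  obtain ⟨A, hA, k, hk⟩ := exists_qtheta_zpow_mul (norm_e_lt_one hτ) (e_ne_zero τ) n
  have h1 := (tendsto_div_qtheta_e hτ).comp_sub_const_nhdsNE c
  have hS := (analyticAt_lambertSum hτ (e_add_int_mul_ne_one h)).continuousAt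
  have he := differentiable_e.continuous
  have h2 : ContinuousAt
      (fun z ↦ (z - c) * (e z * lambertSum τ z / (A * e (2 * (z - c)) ^ k))) c := by
    have h3 : ContinuousAt (fun z ↦ e (2 * (z - c)) ^ k) c :=
      ContinuousAt.zpow₀ (by fun_prop) k (.inl (e_ne_zero _))
    refine (continuousAt_id.sub continuousAt_const).mul ((he.continuousAt.mul hS).div
      (continuousAt_const.mul h3) (mul_ne_zero hA (zpow_ne_zero _ (e_ne_zero _))))
  have h4 := (h2.tendsto.mono_left (nhdsWithin_le_nhds (s := {c}ᶜ))).mul h1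
  rw [sub_self, zero_mul, zero_mul] at h4
  refine h4.congr fun z ↦ ?_
  have h5 : e (2 * z) = e τ ^ n * e (2 * (z - c)) := by
    rw [← e_lattice m n τ, ← hc, ← e_add]
    ring_nf
  rw [lambertQuot, h5, hk _ (e_ne_zero _)]
  ring

open Filter Topology in
lemma PeriodPair.tendsto_sq_mul_weierstrassP (L : PeriodPair) :
    Tendsto (fun z ↦ z ^ 2 * L.weierstrassP z) (𝓝[≠] 0) (𝓝 1) := by
  have h : ContinuousAt (fun z ↦ z ^ 2 * L.weierstrassPExcept 0 z + 1) 0 :=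
    ((continuousAt_id.pow 2).mul (L.analyticAt_weierstrassPExcept 0).continuousAt).add
      continuousAt_const
  have h1 := h.tendsto.mono_left (nhdsWithin_le_nhds (s := {0}ᶜ))
  rw [zero_pow two_ne_zero, zero_mul, zero_add] at h1
  refine h1.congr' ?_
  filter_upwards [self_mem_nhdsWithin] with z hz
  have h2 := L.ite_eq_one_sub_sq_mul_weierstrassP 0 (zero_mem _) z
  rw [if_neg (show z ≠ 0 from hz)] at h2
  simpa using h2.symm

open Filter Topology in
/-- Up to a constant, `℘` is a multiple of `lambertQuot`. -/
lemma exists_weierstrassP_add_lambertQuot_eq {τ : ℂ} (hτ : 0 < τ.im) :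
    ∃ C, ∀ u, (∀ m n : ℤ, 2 * u ≠ m + n * τ) →
      (periodPairOne τ hτ).weierstrassP u
        + 4 * Real.pi ^ 2 * qpinf (e τ) (e τ) ^ 2 * lambertQuot τ u = C := by
  set L := periodPairOne τ hτ
  set κ : ℂ := 4 * Real.pi ^ 2 * qpinf (e τ) (e τ) ^ 2
  set F : ℂ → ℂ := fun u ↦ L.weierstrassP u + κ * lambertQuot τ u
  have hper : ∀ z, ∀ l ∈ L.lattice, F (z + l) = F z := by
    intro z l hl
    obtain ⟨m, n, rfl⟩ := mem_periodPairOne.1 hl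
    simp only [F]
    rw [L.weierstrassP_add_coe z ⟨_, hl⟩, lambertQuot_add_lattice hτ]
  have hneg : ∀ z, F (-z) = F z := fun z ↦ by
    simp only [F, L.weierstrassP_neg, lambertQuot_neg hτ]
  have hF : ∀ z, MeromorphicAt F z := fun z ↦
    (L.meromorphic_weierstrassP z).add (analyticAt_const.meromorphicAt.mul
      (meromorphicAt_lambertQuot hτ z))
  have hP : ∀ z, (∀ m n : ℤ, z ≠ m + n * τ) → AnalyticAt ℂ L.weierstrassP z := by
    intro z hz
    refine L.analyticOnNhd_weierstrassP z fun hl ↦ ?_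
    obtain ⟨m, n, h⟩ := mem_periodPairOne.1 hl
    exact hz m n h
  have hFan : ∀ z, (∀ m n : ℤ, 2 * z ≠ m + n * τ) → AnalyticAt ℂ F z := fun z hz ↦
    (hP z (ne_lattice_of_two_mul_ne hz)).add
      (analyticAt_const.mul (analyticAt_lambertQuot hτ hz))
  have hzero : Tendsto (fun z ↦ z ^ 2 * F z) (𝓝[≠] 0) (𝓝 0) := by
    have h := L.tendsto_sq_mul_weierstrassP.add (tendsto_sq_mul_lambertQuot_zero hτ)
    rw [add_neg_cancel] at h
    exact h.congr fun z ↦ (mul_add _ _ _).symm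
  have hlim : ∀ c, ∀ m n : ℤ, 2 * c = m + n * τ →
      Tendsto (fun z ↦ (z - c) ^ 2 * F z) (𝓝[≠] c) (𝓝 0) := by
    intro c m n hc
    by_cases hl : c ∈ L.lattice
    · refine (hzero.comp_sub_const_nhdsNE c).congr fun z ↦ ?_
      rw [← hper (z - c) c hl, sub_add_cancel]
    · have hc' : ∀ m n : ℤ, c ≠ m + n * τ := fun m n h ↦ hl (mem_periodPairOne.2 ⟨m, n, h⟩)
      have h1 : ContinuousAt (fun z ↦ (z - c) ^ 2 * L.weierstrassP z) c :=
        ((continuousAt_id.sub continuousAt_const).pow 2).mul (hP c hc').continuousAt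
      have h2 := (h1.tendsto.mono_left (nhdsWithin_le_nhds (s := {c}ᶜ))).add
        ((tendsto_sq_mul_lambertQuot hτ hc' hc).const_mul κ)
      rw [sub_self, zero_pow two_ne_zero, zero_mul, mul_zero, zero_add] at h2
      refine h2.congr fun z ↦ ?_
      simp only [F]
      ring
  have hord : ∀ z, 0 ≤ meromorphicOrderAt F z := by
    intro c
    by_cases hc : ∀ m n : ℤ, 2 * c ≠ m + n * τ
    · exact (hFan c hc).meromorphicOrderAt_nonneg
    · push Not at hc
      obtain ⟨m, n, hc⟩ := hc
      refine meromorphicOrderAt_nonneg_of_symm (hF c) (fun z ↦ ?_) (hlim c m n hc)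
      rw [← hneg (c - z), ← hper (-(c - z)) (2 * c) (mem_periodPairOne.2 ⟨m, n, hc⟩)]
      ring_nf
  obtain ⟨C, hC⟩ := L.exists_const_of_meromorphicOrderAt_nonneg hF hper hord
  exact ⟨C, fun u hu ↦ hC u (hFan u hu).continuousAt⟩

/-! ### The bilateral series -/

lemma qpint_div_qpint {q a : ℂ} (hq : ‖q‖ < 1) (hq0 : q ≠ 0) (h : ∀ m : ℤ, a ≠ q ^ m) (n : ℤ) :
    qpint a q n / qpint (a / q) q n = (1 - a / q * q ^ n) / (1 - a / q) := by
  have h1 : qpinf a q ≠ 0 := qpinf_ne_zero_of_ne_zpow hq h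
  have h2 : qpinf (a * q ^ n) q ≠ 0 := qpinf_ne_zero_of_ne_zpow hq fun m hm ↦ by
    refine h (m - n) ?_
    rw [zpow_sub₀ hq0, ← hm, mul_div_cancel_right₀ _ (zpow_ne_zero n hq0)]
  have h3 : qpinf (a / q) q = (1 - a / q) * qpinf a q := by
    rw [qpinf_eq_mul hq, div_mul_cancel₀ _ hq0]
  have h4 : qpinf (a / q * q ^ n) q = (1 - a / q * q ^ n) * qpinf (a * q ^ n) q := by
    rw [qpinf_eq_mul hq]
    congr 2
    field_simp
  rw [qpint, qpint, h3, h4]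
  field_simp

@[simp] lemma qpint_zero (q : ℂ) (n : ℤ) : qpint 0 q n = 1 := by simp [qpint]

lemma sign_mul_zpow_pow_four (q : ℂ) (n : ℤ) :
    ((-1 : ℂ) ^ n * q ^ ((n * (n - 1)) / 2)) ^ 4 = q ^ (2 * (n * (n - 1))) := by
  have h1 : ((-1 : ℂ) ^ n) ^ 4 = 1 := by
    rw [← zpow_natCast, ← zpow_mul, mul_comm, zpow_mul]
    norm_num
  rw [mul_pow, h1, one_mul, ← zpow_natCast, ← zpow_mul]
  congr 1
  obtain ⟨k, hk⟩ := Int.even_mul_pred_self n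
  rw [hk]
  push_cast
  lia

lemma psi26_eq_lambertSum {τ u : ℂ} (hτ : 0 < τ.im) (h : ∀ m : ℤ, e u ≠ e τ ^ m)
    (h' : ∀ m : ℤ, -e u ≠ e τ ^ m) :
    psi26 (e τ) (e u)
      = (e τ - e u) / (e τ + e u) * (e u ^ 4 / e τ ^ 2) * lambertSum τ u := by
  have hq := norm_e_lt_one hτ
  have hq0 := e_ne_zero τ
  have hx := e_ne_zero u
  rw [psi26, lambertSum, ← tsum_mul_left, ← (Equiv.addRight (1 : ℤ)).tsum_eq]
  refine tsum_congr fun m ↦ ?_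
  have h1 := qpint_div_qpint hq hq0 h (m + 1)
  have h2 := qpint_div_qpint hq hq0 h' (m + 1)
  have h3 : e (4 * m * u + 2 * m ^ 2 * τ) = e u ^ (4 * m) * e τ ^ (2 * m ^ 2) := by
    rw [← e_int_mul, ← e_int_mul, ← e_add]
    push_cast
    ring_nf
  have h4 : e τ ^ (2 * ((m + 1) * (m + 1 - 1))) * (e u ^ 4 / e τ ^ 2) ^ (m + 1)
      = e u ^ 4 / e τ ^ 2 * (e u ^ (4 * m) * e τ ^ (2 * m ^ 2)) := by
    have h5 : (e τ ^ 2) ^ m = e τ ^ (2 * m) := by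
      rw [← zpow_natCast, ← zpow_mul]; rfl
    have h6 : (e u ^ 4) ^ m = e u ^ (4 * m) := by
      rw [← zpow_natCast, ← zpow_mul]; rfl
    rw [show 2 * ((m + 1) * (m + 1 - 1)) = 2 * m ^ 2 + 2 * m by ring, zpow_add₀ hq0,
      zpow_add_one₀ (by positivity), div_zpow, h5, h6]
    field_simp
  have h7 : e (u + m * τ) = e u * e τ ^ m := by rw [e_add, e_int_mul]
  simp only [Equiv.coe_addRight, qpint_zero, mul_one, lambertTerm, jacobiTheta₂_term_eq_e]
  have h8 : qpint (-e u) (e τ) (m + 1) * qpint (e u / e τ) (e τ) (m + 1) /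
      (qpint (-e u / e τ) (e τ) (m + 1) * qpint (e u) (e τ) (m + 1))
      = (1 - -e u / e τ * e τ ^ (m + 1)) / (1 - -e u / e τ)
        / ((1 - e u / e τ * e τ ^ (m + 1)) / (1 - e u / e τ)) := by
    rw [← h1, ← h2, div_div_div_eq]
  have h9 : ∀ a : ℂ, a / e τ * e τ ^ (m + 1) = a * e τ ^ m := fun a ↦ by
    rw [zpow_add_one₀ hq0]
    field_simp
  have h10 : (1 - e u / e τ) / (1 - -e u / e τ) = (e τ - e u) / (e τ + e u) := by
    rw [← mul_div_mul_right _ _ hq0]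
    congr 1 <;> field_simp
    ring
  rw [sign_mul_zpow_pow_four, mul_assoc, h4, h8, h9, h9, h3, h7, ← h10]
  simp only [div_eq_mul_inv, mul_inv, inv_inv]
  ring

lemma qtheta_sq_div_sq {q x : ℂ} (hq : ‖q‖ < 1) (hq0 : q ≠ 0) (hx : x ≠ 0) :
    qtheta q (x ^ 2 / q ^ 2) = x ^ 4 / q ^ 3 * qtheta q (x ^ 2) := by
  have h1 := qtheta_mul hq hq0 (x := x ^ 2 / q ^ 2) (by positivity)
  have h2 := qtheta_mul hq hq0 (x := q * (x ^ 2 / q ^ 2)) (by positivity)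
  rw [h1, show q * (q * (x ^ 2 / q ^ 2)) = x ^ 2 by field_simp] at h2
  rw [h2]
  field_simp

lemma psi26_expansion_eq_lambertQuot {τ u : ℂ} (hτ : 0 < τ.im) (h : ∀ m n : ℤ, u ≠ m + n * τ)
    (h' : ∀ m : ℤ, -e u ≠ e τ ^ m) :
    4 * (Real.pi : ℂ) ^ 2 * e u / e τ * ((e τ + e u) / (e τ - e u)) *
          (qpinf (e τ) (e τ) ^ 2 / qtheta (e τ) (e u ^ 2 / e τ ^ 2)) * psi26 (e τ) (e u)
      = 4 * Real.pi ^ 2 * qpinf (e τ) (e τ) ^ 2 * lambertQuot τ u := by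
  have hx : ∀ m : ℤ, e u ≠ e τ ^ m := fun n hn ↦ by
    obtain ⟨m, hm⟩ := e_eq_zpow_iff.1 hn
    exact h m n hm
  have h1 : e τ - e u ≠ 0 := fun h0 ↦ hx 1 (by linear_combination -h0 - zpow_one (e τ))
  have h2 : e τ + e u ≠ 0 := fun h0 ↦ h' 1 (by linear_combination -h0 - zpow_one (e τ))
  have hq0 := e_ne_zero τ
  have hx0 := e_ne_zero u
  have h3 : e (2 * u) = e u ^ 2 := by
    rw [sq, ← e_add, two_mul]
  rw [psi26_eq_lambertSum hτ hx h', qtheta_sq_div_sq (norm_e_lt_one hτ) hq0 hx0, lambertQuot, h3]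
  field_simp

theorem stmt14 (τ u v : ℂ) (hτ : 0 < τ.im)
    (hu : ∀ m n : ℤ, u ≠ (m : ℂ) + (n : ℂ) * τ)
    (hv : ∀ m n : ℤ, v ≠ (m : ℂ) + (n : ℂ) * τ)
    (hu2 : ∀ m n : ℤ, 2 * u ≠ (m : ℂ) + (n : ℂ) * τ)
    (hv2 : ∀ m n : ℤ, 2 * v ≠ (m : ℂ) + (n : ℂ) * τ)
    (q x y : ℂ) (hq : q = e τ) (hx : x = e u) (hy : y = e v)
    (hmx : ∀ m : ℤ, -x ≠ q ^ m) (hmy : ∀ m : ℤ, -y ≠ q ^ m) :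
    wp τ u - wp τ v =
      - (4 * (Real.pi : ℂ) ^ 2 * x / q) * ((q + x) / (q - x)) *
          (qpinf q q ^ 2 / qtheta q (x ^ 2 / q ^ 2)) * psi26 q x
      + (4 * (Real.pi : ℂ) ^ 2 * y / q) * ((q + y) / (q - y)) *
          (qpinf q q ^ 2 / qtheta q (y ^ 2 / q ^ 2)) * psi26 q y := by
  subst hq hx hy
  obtain ⟨C, hC⟩ := exists_weierstrassP_add_lambertQuot_eq hτ
  rw [wp_eq_weierstrassP hτ, wp_eq_weierstrassP hτ]
  linear_combination hC u hu2 - hC v hv2 + psi26_expansion_eq_lambertQuot hτ hu hmx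
    - psi26_expansion_eq_lambertQuot hτ hv hmy
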